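/- arXiv:1009.4375 — 2 statements merged into one kernel-verified Lean document; each statement's English description precedes it below -/
import Mathlib

section
/- Quantitative Sylvester–Gallai theorem: Let δ ∈ (0,1] and let v₁,…,v_n ∈ ℂ^d be n distinct points forming a δ-SG configuration. Then the affine dimension of {v₁,…,v_n} is less than 13/δ². -/
open scoped Classical

/-- Approximate matrix scaling: a nonnegative matrix `a` whose `r`-th row has a positive entry in
column `φ r` admits positive column multipliers `E` such that, once row `r` is normalised to have
sum `w r`, the sum of column `j` is at least `c j`, for any `c j` below the total weight of the
rows marked by `j`. -/
theorem exists_column_scaling {ι κ : Type*} [Fintype ι] [Fintype κ]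
    (w : ι → ℝ) (hw : ∀ r, 0 ≤ w r) (a : ι → κ → ℝ) (ha : ∀ r j, 0 ≤ a r j)
    (φ : ι → κ) (hφ : ∀ r, 0 < a r (φ r)) (c : κ → ℝ)
    (hc : ∀ j, c j < ∑ r, if φ r = j then w r else 0) :
    ∃ E : κ → ℝ, (∀ j, 0 < E j) ∧
      ∀ j, c j ≤ ∑ r, w r * (a r j * E j / ∑ l, a r l * E l) := by
  set d : κ → ℝ := fun j => ∑ r, if φ r = j then w r else 0 with hd
  set u : (κ → ℝ) → ι → ℝ := fun x r => ∑ l, a r l * Real.exp (x l) with hu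
  set g : (κ → ℝ) → ℝ := fun x => ∑ r, w r * Real.log (u x r) - ∑ j, c j * x j with hg
  set C : ℝ := ∑ r, w r * Real.log (a r (φ r)) with hC
  have hule : ∀ x r, a r (φ r) * Real.exp (x (φ r)) ≤ u x r := fun x r =>
    Finset.single_le_sum (f := fun l => a r l * Real.exp (x l))
      (fun l _ => mul_nonneg (ha r l) (Real.exp_pos _).le) (Finset.mem_univ _)
  have hupos : ∀ x r, 0 < u x r := fun x r =>
    (mul_pos (hφ r) (Real.exp_pos _)).trans_le (hule x r)
  have hlower : ∀ x, C + ∑ j, (d j - c j) * x j ≤ g x := by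
    intro x
    have h1 : ∑ r, w r * (Real.log (a r (φ r)) + x (φ r)) ≤ ∑ r, w r * Real.log (u x r) := by
      refine Finset.sum_le_sum fun r _ => mul_le_mul_of_nonneg_left ?_ (hw r)
      have h := Real.log_le_log (mul_pos (hφ r) (Real.exp_pos _)) (hule x r)
      rwa [Real.log_mul (hφ r).ne' (Real.exp_pos _).ne', Real.log_exp] at h
    have h2 : ∑ j, d j * x j = ∑ r, w r * x (φ r) := by
      simp only [hd, Finset.sum_mul]
      rw [Finset.sum_comm]
      simp [ite_mul]
    simp only [mul_add, Finset.sum_add_distrib] at h1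
    simp only [hg, sub_mul, Finset.sum_sub_distrib, h2]
    linarith
  have hcont : Continuous g := by
    refine Continuous.sub (continuous_finsetSum _ fun r _ => continuous_const.mul ?_) (by fun_prop)
    exact Continuous.log (by fun_prop) fun x => (hupos x r).ne'
  obtain ⟨x, hx0, hx⟩ : ∃ x ∈ Set.Ici (0 : κ → ℝ), IsMinOn g (Set.Ici 0) x := by
    refine hcont.continuousOn.exists_isMinOn' isClosed_Ici (x₀ := 0) (by simp) ?_
    set R : ℝ := ∑ j, |g 0 - C| / (d j - c j) with hR
    have hRj : ∀ j, |g 0 - C| / (d j - c j) ≤ R := fun j =>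
      Finset.single_le_sum (f := fun j => |g 0 - C| / (d j - c j))
        (fun j _ => div_nonneg (abs_nonneg _) (sub_nonneg.2 (hc j).le)) (Finset.mem_univ j)
    rw [Filter.eventually_inf_principal]
    filter_upwards [(isCompact_Icc (a := (0 : κ → ℝ)) (b := fun _ => R)).compl_mem_cocompact]
      with y hy hy0
    obtain ⟨j, hj⟩ : ∃ j, R < y j := by
      by_contra! h
      exact hy ⟨hy0, h⟩
    have h1 : (d j - c j) * y j ≤ ∑ j, (d j - c j) * y j :=
      Finset.single_le_sum (f := fun j => (d j - c j) * y j)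
        (fun i _ => mul_nonneg (sub_nonneg.2 (hc i).le) (hy0 i)) (Finset.mem_univ j)
    have h2 : |g 0 - C| ≤ (d j - c j) * y j := by
      have h := (hRj j).trans hj.le
      rwa [div_le_iff₀' (sub_pos.2 (hc j))] at h
    linarith [hlower y, le_abs_self (g 0 - C)]
  refine ⟨fun j => Real.exp (x j), fun j => Real.exp_pos _, fun j => ?_⟩
  set s : ℝ := ∑ r, w r * (a r j * Real.exp (x j) / u x r) with hs
  have hs0 : 0 ≤ s := Finset.sum_nonneg fun r _ => mul_nonneg (hw r)
    (div_nonneg (mul_nonneg (ha r j) (Real.exp_pos _).le) (hupos x r).le)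
  have hstep : ∀ t, 0 ≤ t → c j * t ≤ s * (Real.exp t - 1) := by
    intro t ht
    have hmin : g x ≤ g (x + (Pi.single j t : κ → ℝ)) := by
      apply hx
      intro i
      by_cases h : i = j
      · subst h; simpa using add_nonneg (hx0 i) ht
      · simpa [h] using hx0 i
    have hushift : ∀ r, u (x + (Pi.single j t : κ → ℝ)) r =
        u x r + a r j * Real.exp (x j) * (Real.exp t - 1) := by
      intro r
      have : ∀ l, a r l * Real.exp ((x + (Pi.single j t : κ → ℝ)) l) = a r l * Real.exp (x l) +
          if l = j then a r j * Real.exp (x j) * (Real.exp t - 1) else 0 := by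
        intro l
        by_cases h : l = j
        · subst h; simp [Real.exp_add]; ring
        · simp [h]
      simp only [hu, this, Finset.sum_add_distrib, Finset.sum_ite_eq', Finset.mem_univ, if_true]
    have hlog : ∑ r, w r * Real.log (u (x + (Pi.single j t : κ → ℝ)) r) ≤
        ∑ r, w r * Real.log (u x r) + s * (Real.exp t - 1) := by
      rw [hs, Finset.sum_mul, ← Finset.sum_add_distrib]
      refine Finset.sum_le_sum fun r _ => ?_
      rw [mul_assoc, ← mul_add]
      refine mul_le_mul_of_nonneg_left ?_ (hw r)
      have h := Real.log_le_sub_one_of_pos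
        (div_pos (hupos (x + (Pi.single j t : κ → ℝ)) r) (hupos x r))
      rw [Real.log_div (hupos _ r).ne' (hupos _ r).ne', hushift, add_div,
        div_self (hupos x r).ne'] at h
      rw [hushift, div_mul_eq_mul_div]
      linarith
    have hlin : ∑ i, c i * (x + (Pi.single j t : κ → ℝ)) i = ∑ i, c i * x i + c j * t := by
      simp [mul_add, Finset.sum_add_distrib, Pi.single_apply]
    simp only [hg, hlin] at hmin
    linarith
  refine le_of_forall_pos_le_add fun ε hε => ?_
  set t : ℝ := min 1 (ε / (s + 1)) with ht
  have ht0 : 0 < t := lt_min one_pos (by positivity)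
  have hexp := Real.abs_exp_sub_one_sub_id_le (x := t)
    (by rw [abs_of_pos ht0]; exact min_le_left _ _)
  have h1 := hstep t ht0.le
  have h2 : s * (Real.exp t - 1) ≤ s * (t + t ^ 2) :=
    mul_le_mul_of_nonneg_left (by linarith [(abs_le.1 hexp).2]) hs0
  have h3 : c j ≤ s * (1 + t) := by
    refine le_of_mul_le_mul_right ?_ ht0
    nlinarith
  have h4 : t * (s + 1) ≤ ε := by
    rw [← le_div_iff₀ (by positivity)]
    exact min_le_right _ _
  change c j ≤ s + ε
  nlinarith

/-- A matrix fixing a subspace pointwise has squared Frobenius norm at least the dimension of that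
subspace. -/
theorem finrank_le_sum_norm_sq {κ : Type*} [Fintype κ] (N : κ → κ → ℂ)
    (V : Submodule ℂ (EuclideanSpace ℂ κ)) (hV : ∀ q ∈ V, ∀ i, ∑ j, N i j * q j = q i) :
    (Module.finrank ℂ V : ℝ) ≤ ∑ i, ∑ j, ‖N i j‖ ^ 2 := by
  set b := stdOrthonormalBasis ℂ V
  have hb : Orthonormal ℂ fun α => (b α : EuclideanSpace ℂ κ) :=
    b.orthonormal.comp_linearIsometry V.subtypeₗᵢ
  have h1 : ∀ α, ∑ i, ‖(b α : EuclideanSpace ℂ κ) i‖ ^ 2 = 1 := by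
    intro α
    rw [← EuclideanSpace.norm_sq_eq, hb.1 α, one_pow]
  calc (Module.finrank ℂ V : ℝ) = ∑ α, ∑ i, ‖(b α : EuclideanSpace ℂ κ) i‖ ^ 2 := by simp [h1]
    _ = ∑ i, ∑ α, ‖(b α : EuclideanSpace ℂ κ) i‖ ^ 2 := Finset.sum_comm
    _ ≤ ∑ i, ∑ j, ‖N i j‖ ^ 2 := Finset.sum_le_sum fun i _ => by
      have h := hb.sum_inner_products_le (s := Finset.univ)
        (WithLp.toLp 2 fun j => star (N i j) : EuclideanSpace ℂ κ)
      rw [EuclideanSpace.norm_sq_eq] at h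
      simp only [norm_star] at h
      refine le_trans (Finset.sum_le_sum fun α _ => ?_) h
      rw [← hV _ (b α).2 i, ← norm_inner_symm]
      refine le_of_eq ?_
      congr 2
      simp [PiLp.inner_apply, mul_comm]

/-- Rank bound for weighted design matrices, phrased through a subspace of the kernel. -/
theorem finrank_le_of_weighted_design {ι κ : Type*} [Fintype ι] [Fintype κ]
    (w : ι → ℝ) (hw : ∀ r, 0 ≤ w r) (A : ι → κ → ℂ) (φ : ι → κ) (hφ : ∀ r, A r (φ r) ≠ 0)
    (t c : ℝ) (ht0 : 0 ≤ t) (hc0 : 0 < c) (hc : ∀ j, c < ∑ r, if φ r = j then w r else 0)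
    (ht : ∀ i j, i ≠ j → (∑ r, if A r i ≠ 0 ∧ A r j ≠ 0 then w r else 0) ≤ t)
    (V : Submodule ℂ (κ → ℂ)) (hV : ∀ y ∈ V, ∀ r, w r ≠ 0 → ∑ j, A r j * y j = 0) :
    (Module.finrank ℂ V : ℝ) ≤ Fintype.card κ * (t / c) := by
  obtain ⟨E, hE, hs⟩ := exists_column_scaling w hw (fun r j => ‖A r j‖ ^ 2)
    (fun r j => by positivity) φ (fun r => by have := norm_pos_iff.2 (hφ r); positivity)
    (fun _ => c) hc
  set u : ι → ℝ := fun r => ∑ l, ‖A r l‖ ^ 2 * E l with hu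
  have hu0 : ∀ r, 0 < u r := fun r => Finset.sum_pos'
    (fun l _ => mul_nonneg (by positivity) (hE l).le)
    ⟨φ r, Finset.mem_univ _, mul_pos (by have := norm_pos_iff.2 (hφ r); positivity) (hE _)⟩
  set s : κ → ℝ := fun j => ∑ r, w r * (‖A r j‖ ^ 2 * E j / u r) with hsdef
  have hs0 : ∀ j, 0 < s j := fun j => hc0.trans_le (hs j)
  set b : ι → κ → ℂ := fun r j => A r j * (Real.sqrt (E j) : ℂ) with hb
  have hbn : ∀ r j, ‖b r j‖ ^ 2 = ‖A r j‖ ^ 2 * E j := fun r j => by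
    simp [hb, mul_pow, abs_of_nonneg (Real.sqrt_nonneg _), Real.sq_sqrt (hE j).le]
  set M : κ → κ → ℂ := fun i j => ∑ r, (w r / u r : ℝ) * (star (b r i) * b r j) with hM
  have hMdiag : ∀ i, M i i = s i := fun i => by
    simp only [hM, hsdef, Complex.ofReal_sum]
    refine Finset.sum_congr rfl fun r _ => ?_
    have : star (b r i) * b r i = ((‖b r i‖ ^ 2 : ℝ) : ℂ) := by
      rw [Complex.star_def, Complex.conj_mul']; norm_cast
    rw [this, hbn, ← Complex.ofReal_mul]
    congr 1
    ring
  have hMoff : ∀ i j, i ≠ j →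
      ‖M i j‖ ^ 2 ≤ t * ∑ r, w r / u r ^ 2 * (‖b r i‖ ^ 2 * ‖b r j‖ ^ 2) := by
    intro i j hij
    have h1 : ‖M i j‖ ≤ ∑ r, Real.sqrt (if A r i ≠ 0 ∧ A r j ≠ 0 then w r else 0) *
        (Real.sqrt (w r) / u r * (‖b r i‖ * ‖b r j‖)) := by
      refine (norm_sum_le _ _).trans (Finset.sum_le_sum fun r _ => le_of_eq ?_)
      rw [norm_mul, norm_mul (star (b r i)), norm_star, Complex.norm_real,
        Real.norm_of_nonneg (div_nonneg (hw r) (hu0 r).le)]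
      split_ifs with h
      · rw [← mul_assoc (Real.sqrt (w r)), ← mul_div_assoc, Real.mul_self_sqrt (hw r)]
      · rw [not_and_or, not_not, not_not] at h
        rcases h with h | h <;> simp [hb, h]
    have h2 := pow_le_pow_left₀ (norm_nonneg _) h1 2
    refine h2.trans ((Finset.sum_mul_sq_le_sq_mul_sq _ _ _).trans ?_)
    refine mul_le_mul ?_ (le_of_eq ?_) (Finset.sum_nonneg fun _ _ => sq_nonneg _) ht0
    · refine le_trans (le_of_eq (Finset.sum_congr rfl fun r _ => Real.sq_sqrt ?_)) (ht i j hij)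
      split_ifs <;> simp [hw]
    · refine Finset.sum_congr rfl fun r _ => ?_
      rw [mul_pow, mul_pow, div_pow, Real.sq_sqrt (hw r)]
  set N : κ → κ → ℂ := fun i j => if i = j then 0 else -M i j / s i with hN
  set e : (κ → ℂ) →ₗ[ℂ] EuclideanSpace ℂ κ :=
    (WithLp.linearEquiv 2 ℂ (κ → ℂ)).symm.toLinearMap ∘ₗ
      LinearMap.pi fun j => ((Real.sqrt (E j) : ℂ)⁻¹) • LinearMap.proj j with he
  have hsqrt : ∀ j, (Real.sqrt (E j) : ℂ) ≠ 0 := fun j =>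
    Complex.ofReal_ne_zero.2 (Real.sqrt_pos.2 (hE j)).ne'
  have heapp : ∀ y j, e y j = (Real.sqrt (E j) : ℂ)⁻¹ * y j := fun y j => by simp [he]
  have heinj : Function.Injective e := fun y z h => funext fun j => by
    have h' := congrArg (fun q : EuclideanSpace ℂ κ => q j) h
    simp only [heapp] at h'
    exact mul_left_cancel₀ (inv_ne_zero (hsqrt j)) h'
  have hfix : ∀ q ∈ V.map e, ∀ i, ∑ j, N i j * q j = q i := by
    rintro _ ⟨y, hy, rfl⟩ i
    have hker : ∑ j, M i j * e y j = 0 := by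
      simp only [hM, Finset.sum_mul]
      rw [Finset.sum_comm]
      refine Finset.sum_eq_zero fun r _ => ?_
      by_cases hr : w r = 0
      · simp [hr]
      · have : ∀ j, ((w r / u r : ℝ) : ℂ) * (star (b r i) * b r j) * e y j =
            ((w r / u r : ℝ) : ℂ) * star (b r i) * (A r j * y j) := fun j => by
          rw [heapp, hb]
          field_simp [hsqrt j]
        simp only [this, ← Finset.mul_sum, hV y hy r hr, mul_zero]
    have hsi : (s i : ℂ) ≠ 0 := Complex.ofReal_ne_zero.2 (hs0 i).ne'
    have : ∀ j, N i j * e y j = -(M i j * e y j) / s i + if i = j then e y i else 0 := fun j => by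
      by_cases h : i = j
      · subst h
        simp only [hN, if_true, hMdiag]
        field_simp
        ring
      · simp only [hN, h, if_false]
        ring
    simp only [this, Finset.sum_add_distrib, ← Finset.sum_div, Finset.sum_neg_distrib, hker]
    simp
  have hrow : ∀ i, ∑ j, ‖N i j‖ ^ 2 ≤ t / c := by
    intro i
    have hu_sum : ∀ r, ∑ j, ‖b r j‖ ^ 2 = u r := fun r => by simp only [hbn, hu]
    calc ∑ j, ‖N i j‖ ^ 2
        ≤ ∑ j, t / s i ^ 2 * ∑ r, w r / u r ^ 2 * (‖b r i‖ ^ 2 * ‖b r j‖ ^ 2) := by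
          refine Finset.sum_le_sum fun j _ => ?_
          by_cases h : i = j
          · simp only [hN, h, if_true, norm_zero]
            exact (zero_pow two_ne_zero).trans_le <| mul_nonneg (by positivity) <|
              Finset.sum_nonneg fun r _ => mul_nonneg (div_nonneg (hw r) (sq_nonneg _))
                (by positivity)
          · simp only [hN, h, if_false]
            rw [norm_div, norm_neg, Complex.norm_real, Real.norm_of_nonneg (hs0 i).le, div_pow,
              div_mul_eq_mul_div]
            exact div_le_div_of_nonneg_right (hMoff i j h) (sq_nonneg _)
      _ = t / s i ^ 2 * s i := by
          rw [← Finset.mul_sum, Finset.sum_comm]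
          congr 1
          refine Finset.sum_congr rfl fun r _ => ?_
          rw [← Finset.mul_sum, ← Finset.mul_sum, hu_sum, hbn]
          have := (hu0 r).ne'
          field_simp
      _ = t / s i := by
          have := (hs0 i).ne'
          field_simp
      _ ≤ t / c := div_le_div_of_nonneg_left ht0 hc0 (hs i)
  calc (Module.finrank ℂ V : ℝ) = Module.finrank ℂ (V.map e) := by
        rw [(Submodule.equivMapOfInjective e heinj V).finrank_eq]
    _ ≤ ∑ i, ∑ j, ‖N i j‖ ^ 2 := finrank_le_sum_norm_sq N _ hfix
    _ ≤ ∑ i : κ, t / c := Finset.sum_le_sum fun i _ => hrow i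
    _ = Fintype.card κ * (t / c) := by simp

section Weights

variable {ι E : Type*} [Fintype ι] [AddCommGroup E] [Module ℂ E]

/-- The indices of the configuration points, other than `v i` and `v j`, collinear with them. -/
noncomputable def thirdPoints (v : ι → E) (i j : ι) : Finset ι :=
  Finset.univ.filter fun k => k ≠ i ∧ k ≠ j ∧ Collinear ℂ ({v i, v j, v k} : Set E)

theorem mem_thirdPoints {v : ι → E} {i j k : ι} :
    k ∈ thirdPoints v i j ↔ k ≠ i ∧ k ≠ j ∧ Collinear ℂ ({v i, v j, v k} : Set E) := by
  simp [thirdPoints]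

theorem thirdPoints_comm (v : ι → E) (i j : ι) : thirdPoints v i j = thirdPoints v j i := by
  ext k
  rw [mem_thirdPoints, mem_thirdPoints, Set.insert_comm]
  tauto

theorem collinear_triple_swap {a b c : E} (h : Collinear ℂ ({a, b, c} : Set E)) :
    Collinear ℂ ({a, c, b} : Set E) := by
  rwa [Set.pair_comm]

theorem mem_thirdPoints_swap {v : ι → E} {i j k : ι} (hij : i ≠ j)
    (h : k ∈ thirdPoints v i j) : j ∈ thirdPoints v i k := by
  rw [mem_thirdPoints] at h ⊢
  exact ⟨hij.symm, h.2.1.symm, collinear_triple_swap h.2.2⟩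

theorem erase_thirdPoints_subset {v : ι → E} (hv : Function.Injective v) {i j k : ι} (hij : i ≠ j)
    (h : k ∈ thirdPoints v i j) :
    (thirdPoints v i j).erase k ⊆ (thirdPoints v i k).erase j := by
  intro m hm
  rw [Finset.mem_erase, mem_thirdPoints] at hm ⊢
  rw [mem_thirdPoints] at h
  refine ⟨hm.2.2.1, hm.2.1, hm.1, ?_⟩
  have hne : v i ≠ v j := hv.ne hij
  have hk : v k ∈ line[ℂ, v i, v j] :=
    h.2.2.mem_affineSpan_of_mem_of_ne (by simp) (by simp) (by simp) hne
  have hm' : v m ∈ line[ℂ, v i, v j] :=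
    hm.2.2.2.mem_affineSpan_of_mem_of_ne (by simp) (by simp) (by simp) hne
  exact collinear_triple_of_mem_affineSpan_pair (left_mem_affineSpan_pair ℂ _ _) hk hm'

theorem card_thirdPoints_eq {v : ι → E} (hv : Function.Injective v) {i j k : ι} (hij : i ≠ j)
    (h : k ∈ thirdPoints v i j) : (thirdPoints v i j).card = (thirdPoints v i k).card := by
  have hik : i ≠ k := (mem_thirdPoints.1 h).1.symm
  have h' := mem_thirdPoints_swap hij h
  have he : (thirdPoints v i j).erase k = (thirdPoints v i k).erase j :=
    (erase_thirdPoints_subset hv hij h).antisymm (erase_thirdPoints_subset hv hik h')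
  rw [← Finset.card_erase_add_one h, ← Finset.card_erase_add_one h', he]

/-- The weight of a triple of points: triples of distinct collinear points are weighted so that
every pair of points on a special line receives total weight one. -/
noncomputable def tripleWeight (v : ι → E) (i j k : ι) : ℝ :=
  if i ≠ j ∧ k ∈ thirdPoints v i j then ((thirdPoints v i j).card : ℝ)⁻¹ else 0

theorem tripleWeight_nonneg (v : ι → E) (i j k : ι) : 0 ≤ tripleWeight v i j k := by
  unfold tripleWeight
  split_ifs <;> positivity

theorem tripleWeight_swap_left (v : ι → E) (i j k : ι) :
    tripleWeight v i j k = tripleWeight v j i k := by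
  simp only [tripleWeight, thirdPoints_comm v i j, ne_comm (a := i)]

theorem tripleWeight_swap_right {v : ι → E} (hv : Function.Injective v) (i j k : ι) :
    tripleWeight v i j k = tripleWeight v i k j := by
  by_cases h : i ≠ j ∧ k ∈ thirdPoints v i j
  · have hik : i ≠ k := (mem_thirdPoints.1 h.2).1.symm
    rw [tripleWeight, tripleWeight, if_pos h, if_pos ⟨hik, mem_thirdPoints_swap h.1 h.2⟩,
      card_thirdPoints_eq hv h.1 h.2]
  · have h' : ¬(i ≠ k ∧ j ∈ thirdPoints v i k) := fun h' =>
      h ⟨(mem_thirdPoints.1 h'.2).1.symm, mem_thirdPoints_swap h'.1 h'.2⟩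
    rw [tripleWeight, tripleWeight, if_neg h, if_neg h']

theorem sum_tripleWeight (v : ι → E) (i j : ι) :
    ∑ k, tripleWeight v i j k = if i ≠ j ∧ (thirdPoints v i j).Nonempty then 1 else 0 := by
  unfold tripleWeight
  by_cases hij : i = j
  · simp [hij]
  · simp only [ne_eq, hij, not_false_eq_true, true_and]
    rw [Finset.sum_ite_mem, Finset.univ_inter, Finset.sum_const, nsmul_eq_mul]
    split_ifs with h
    · have := h.card_pos
      field_simp
    · simp [Finset.not_nonempty_iff_eq_empty.1 h]

theorem sum_tripleWeight_le_one (v : ι → E) (i j : ι) : ∑ k, tripleWeight v i j k ≤ 1 := by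
  rw [sum_tripleWeight]
  split_ifs <;> norm_num

/-- Triples containing two given points have total weight at most six. -/
theorem sum_tripleWeight_pair_le {v : ι → E} (hv : Function.Injective v) (a b : ι) (hab : a ≠ b) :
    (∑ r : ι × ι × ι, if (a = r.1 ∨ a = r.2.1 ∨ a = r.2.2) ∧ (b = r.1 ∨ b = r.2.1 ∨ b = r.2.2)
      then tripleWeight v r.1 r.2.1 r.2.2 else 0) ≤ 6 := by
  set W := tripleWeight v
  have hW := tripleWeight_nonneg v
  have hle : ∀ r : ι × ι × ι,
      (if (a = r.1 ∨ a = r.2.1 ∨ a = r.2.2) ∧ (b = r.1 ∨ b = r.2.1 ∨ b = r.2.2)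
        then W r.1 r.2.1 r.2.2 else 0) ≤
      (if r.1 = a then if r.2.1 = b then W a b r.2.2 else 0 else 0) +
      (if r.1 = b then if r.2.1 = a then W b a r.2.2 else 0 else 0) +
      (if r.1 = a then if r.2.2 = b then W a b r.2.1 else 0 else 0) +
      (if r.1 = b then if r.2.2 = a then W b a r.2.1 else 0 else 0) +
      (if r.2.1 = a then if r.2.2 = b then W a b r.1 else 0 else 0) +
      (if r.2.1 = b then if r.2.2 = a then W b a r.1 else 0 else 0) := by
    rintro ⟨i, j, k⟩
    dsimp only
    have h23 : W i j k = W i k j := tripleWeight_swap_right hv i j k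
    have h12 : W i j k = W j i k := tripleWeight_swap_left v i j k
    have h12' : W i k j = W k i j := tripleWeight_swap_left v i k j
    have h23' : W j i k = W j k i := tripleWeight_swap_right hv j i k
    have h23'' : W k i j = W k j i := tripleWeight_swap_right hv k i j
    have hnn : ∀ (P Q : Prop) [Decidable P] [Decidable Q] (x y z : ι),
        0 ≤ if P then if Q then W x y z else 0 else 0 := by
      intro P Q _ _ x y z
      split_ifs <;> simp [W, hW]
    have heq : ∀ {P Q : Prop} [Decidable P] [Decidable Q] (x y z : ι), P → Q →
        (if P then if Q then W x y z else 0 else 0) = W x y z := by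
      intro P Q _ _ x y z hP hQ
      rw [if_pos hP, if_pos hQ]
    have n1 := hnn (i = a) (j = b) a b k
    have n2 := hnn (i = b) (j = a) b a k
    have n3 := hnn (i = a) (k = b) a b j
    have n4 := hnn (i = b) (k = a) b a j
    have n5 := hnn (j = a) (k = b) a b i
    have n6 := hnn (j = b) (k = a) b a i
    by_cases h : (a = i ∨ a = j ∨ a = k) ∧ (b = i ∨ b = j ∨ b = k)
    · rw [if_pos h]
      obtain ⟨ha | ha | ha, hb | hb | hb⟩ := h
      · exact absurd (ha.trans hb.symm) hab
      · rw [heq a b k ha.symm hb.symm]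
        simp only [ha, hb] at n1 n2 n3 n4 n5 n6 ⊢
        linarith
      · rw [heq a b j ha.symm hb.symm]
        simp only [ha, hb] at n1 n2 n3 n4 n5 n6 ⊢
        linarith
      · rw [heq b a k hb.symm ha.symm]
        simp only [ha, hb] at n1 n2 n3 n4 n5 n6 ⊢
        linarith
      · exact absurd (ha.trans hb.symm) hab
      · rw [heq a b i ha.symm hb.symm]
        simp only [ha, hb] at n1 n2 n3 n4 n5 n6 ⊢
        linarith
      · rw [heq b a j hb.symm ha.symm]
        simp only [ha, hb] at n1 n2 n3 n4 n5 n6 ⊢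
        linarith
      · rw [heq b a i hb.symm ha.symm]
        simp only [ha, hb] at n1 n2 n3 n4 n5 n6 ⊢
        linarith
      · exact absurd (ha.trans hb.symm) hab
    · rw [if_neg h]
      linarith
  refine (Finset.sum_le_sum fun r _ => hle r).trans ?_
  simp only [Finset.sum_add_distrib, Fintype.sum_prod_type]
  have h1 := sum_tripleWeight_le_one v a b
  have h2 := sum_tripleWeight_le_one v b a
  have e : ∀ x y : ι,
      (∑ i, ∑ j, ∑ k, if i = x then if j = y then W x y k else 0 else 0) = ∑ k, W x y k ∧
      (∑ i, ∑ j, ∑ k, if i = x then if k = y then W x y j else 0 else 0) = ∑ k, W x y k ∧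
      (∑ i, ∑ j, ∑ k, if j = x then if k = y then W x y i else 0 else 0) = ∑ k, W x y k := by
    intro x y
    refine ⟨?_, ?_, ?_⟩ <;>
      simp only [Finset.sum_ite_irrel, Finset.sum_const_zero,
        Finset.sum_ite_eq', Finset.mem_univ, if_true]
  rw [(e a b).1, (e b a).1, (e a b).2.1, (e b a).2.1, (e a b).2.2, (e b a).2.2]
  change ∑ k, W a b k ≤ 1 at h1
  change ∑ k, W b a k ≤ 1 at h2
  linarith

/-- A point collinear with two distinct points is an affine combination of them. -/
theorem exists_collinear_relation {v : ι → E} {i j k : ι} (hij : i ≠ j) (hik : i ≠ k)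
    (hjk : v j ≠ v k) (h : Collinear ℂ ({v i, v j, v k} : Set E)) :
    ∃ A : ι → ℂ, A i ≠ 0 ∧ (∀ l, A l ≠ 0 → l = i ∨ l = j ∨ l = k) ∧
      ∑ l, A l = 0 ∧ ∑ l, A l • v l = 0 := by
  obtain ⟨s, hs⟩ := mem_affineSpan_pair_iff_exists_lineMap_eq.1 <|
    h.mem_affineSpan_of_mem_of_ne (p₁ := v j) (p₂ := v k) (p₃ := v i)
      (by simp) (by simp) (by simp) hjk
  refine ⟨Pi.single i 1 - (1 - s) • Pi.single j 1 - s • Pi.single k 1, ?_, ?_, ?_, ?_⟩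
  · simp [hij, hik]
  · intro l hl
    by_contra! hne
    simp [hne.1, hne.2.1, hne.2.2] at hl
  · simp [Finset.sum_sub_distrib, Pi.single_apply]
  · simp only [Pi.sub_apply, Pi.smul_apply, Pi.single_apply, smul_eq_mul, mul_ite, mul_one, mul_zero,
      sub_smul, ite_smul, one_smul, zero_smul, Finset.sum_sub_distrib, Finset.sum_ite_eq',
      Finset.mem_univ, if_true]
    rw [← hs, AffineMap.lineMap_apply_module]
    module

end Weights

/-- The coordinates of a configuration, taken relative to one of its points, span a space of
functions on the configuration of dimension its affine dimension. -/
theorem finrank_range_coordinates {ι κ : Type*} [Fintype ι] [Fintype κ] (v : ι → κ → ℂ) (i₀ : ι) :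
    Module.finrank ℂ (LinearMap.range (Matrix.of fun i => v i - v i₀).mulVecLin) =
      Module.finrank ℂ (vectorSpan ℂ (Set.range v)) := by
  rw [vectorSpan_range_eq_span_range_vsub_right ℂ v i₀]
  exact Matrix.rank_eq_finrank_span_row _

/-- If every point has at least `m > 1` points (itself included) on its special lines, the affine
dimension of a configuration of `n` points is at most `9 n / (m - 1)`. -/
theorem finrank_vectorSpan_le_of_special_lines {ι κ : Type*} [Fintype ι] [Fintype κ]
    (v : ι → κ → ℂ) (hv : Function.Injective v) (m : ℝ) (hm : 1 < m)
    (hSG : ∀ i, m - 1 ≤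
      ((Finset.univ.filter fun j => i ≠ j ∧ (thirdPoints v i j).Nonempty).card : ℝ)) :
    (Module.finrank ℂ (vectorSpan ℂ (Set.range v)) : ℝ) ≤
      Fintype.card ι * (9 / (m - 1)) := by
  rcases isEmpty_or_nonempty ι with hι | ⟨⟨i₀⟩⟩
  · rw [Set.range_eq_empty, vectorSpan_empty]
    simp
  have hrow : ∀ r : ι × ι × ι, ∃ A : ι → ℂ, A r.1 ≠ 0 ∧
      (∀ l, A l ≠ 0 → l = r.1 ∨ l = r.2.1 ∨ l = r.2.2) ∧
      (tripleWeight v r.1 r.2.1 r.2.2 ≠ 0 → ∑ l, A l = 0 ∧ ∑ l, A l • v l = 0) := by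
    rintro ⟨i, j, k⟩
    by_cases h : i ≠ j ∧ k ∈ thirdPoints v i j
    · obtain ⟨hki, hkj, hcol⟩ := mem_thirdPoints.1 h.2
      obtain ⟨A, h1, h2, h3, h4⟩ := exists_collinear_relation h.1 hki.symm (hv.ne hkj.symm) hcol
      exact ⟨A, h1, h2, fun _ => ⟨h3, h4⟩⟩
    · refine ⟨Pi.single i 1, by simp, fun l hl => Or.inl ?_, fun hw => ?_⟩
      · by_contra hne
        exact hl (by simp [hne])
      · exact absurd (if_neg h) hw
  choose A hA1 hA2 hA3 using hrow
  have hbound := finrank_le_of_weighted_design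
    (fun r : ι × ι × ι => tripleWeight v r.1 r.2.1 r.2.2) (fun r => tripleWeight_nonneg _ _ _ _)
    A (fun r => r.1) hA1 6 (2 / 3 * (m - 1)) (by norm_num) (by linarith) ?_ ?_
    (LinearMap.range (Matrix.of fun i => v i - v i₀).mulVecLin) ?_
  · rw [finrank_range_coordinates] at hbound
    have : 6 / (2 / 3 * (m - 1)) = 9 / (m - 1) := by
      have : m - 1 ≠ 0 := by linarith
      field_simp
      norm_num
    rwa [this] at hbound
  · intro i
    have : (∑ r : ι × ι × ι, if r.1 = i then tripleWeight v r.1 r.2.1 r.2.2 else 0) =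
        ((Finset.univ.filter fun j => i ≠ j ∧ (thirdPoints v i j).Nonempty).card : ℝ) := by
      rw [Fintype.sum_prod_type]
      simp only [Finset.sum_ite_irrel, Finset.sum_const_zero, Finset.sum_ite_eq', Finset.mem_univ,
        if_true, Fintype.sum_prod_type, sum_tripleWeight]
      rw [Finset.sum_boole]
    rw [this]
    linarith [hSG i]
  · intro a b hab
    refine (Finset.sum_le_sum fun r _ => ?_).trans (sum_tripleWeight_pair_le hv a b hab)
    have := tripleWeight_nonneg v r.1 r.2.1 r.2.2
    by_cases h : A r a ≠ 0 ∧ A r b ≠ 0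
    · rw [if_pos h, if_pos ⟨hA2 r a h.1, hA2 r b h.2⟩]
    · rw [if_neg h]
      split_ifs
      · exact this
      · exact le_rfl
  · rintro _ ⟨x, rfl⟩ r hr
    obtain ⟨h0, h1⟩ := hA3 r hr
    have : ∀ l, A r l * (Matrix.of fun i => v i - v i₀).mulVecLin x l =
        (A r l • v l) ⬝ᵥ x - A r l * (v i₀ ⬝ᵥ x) := fun l => by
      change A r l * ((v l - v i₀) ⬝ᵥ x) = _
      rw [sub_dotProduct, mul_sub, smul_dotProduct, smul_eq_mul]
    rw [Finset.sum_congr rfl fun l _ => this l, Finset.sum_sub_distrib, ← Finset.sum_mul, h0,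
      ← sum_dotProduct, h1]
    simp

/-- Quantitative Sylvester–Gallai theorem: if `v₁, …, vₙ` are distinct points of `ℂ^d`
forming a `δ`-SG configuration (for each `i`, the special lines through `vᵢ` — those
containing a third point of the set — cover at least `δn` of the points), then the
affine dimension of the configuration is less than `13/δ²`. -/
theorem quantitative_sylvester_gallai {n d : ℕ} (δ : ℝ) (hδ0 : 0 < δ) (hδ1 : δ ≤ 1)
    (v : Fin n → (Fin d → ℂ)) (hv : Function.Injective v)
    (hSG : ∀ i : Fin n, δ * n ≤
      ((Finset.univ.filter fun j : Fin n => j = i ∨ ∃ k : Fin n,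
        k ≠ i ∧ k ≠ j ∧ j ≠ i ∧
        Collinear ℂ ({v i, v j, v k} : Set (Fin d → ℂ))).card : ℝ)) :
    (Module.finrank ℂ (vectorSpan ℂ (Set.range v)) : ℝ) < 13 / δ ^ 2 := by
  rcases lt_or_ge (n : ℝ) (13 / δ ^ 2) with hlt | hge
  · refine lt_of_le_of_lt ?_ hlt
    rcases isEmpty_or_nonempty (Fin n) with hι | ⟨⟨i₀⟩⟩
    · rw [Set.range_eq_empty, vectorSpan_empty]
      simp
    · rw [← finrank_range_coordinates v i₀]
      exact_mod_cast (Matrix.rank_le_height _)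
  · rw [div_le_iff₀ (by positivity)] at hge
    have hδδ : 13 ≤ δ * n := by nlinarith [(Nat.cast_nonneg n : (0 : ℝ) ≤ n)]
    have hspecial : ∀ i, δ * n - 1 ≤
        ((Finset.univ.filter fun j => i ≠ j ∧ (thirdPoints v i j).Nonempty).card : ℝ) := by
      intro i
      refine sub_le_iff_le_add.2 ((hSG i).trans ?_)
      rw [← Nat.cast_add_one]
      refine Nat.cast_le.2 ((Finset.card_le_card ?_).trans (Finset.card_insert_le i _))
      intro j hj
      rw [Finset.mem_filter] at hj
      rw [Finset.mem_insert, Finset.mem_filter]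
      rcases hj.2 with h | ⟨k, hki, hkj, hji, hcol⟩
      · exact Or.inl h
      · exact Or.inr ⟨Finset.mem_univ _, hji.symm, k, mem_thirdPoints.2 ⟨hki, hkj, hcol⟩⟩
    have hbound := finrank_vectorSpan_le_of_special_lines v hv (δ * n) (by linarith)
      fun i => by convert hspecial i
    refine hbound.trans_lt ?_
    rw [Fintype.card_fin, ← mul_div_assoc, div_lt_div_iff₀ (by linarith) (by positivity)]
    nlinarith [mul_nonneg hδ0.le (Nat.cast_nonneg n : (0 : ℝ) ≤ n)]
end

section
/- If v₁,…,v_n ∈ ℂ^d is a 1-SG configuration of distinct points, then the affine dimension of {v₁,…,v_n} is at most 10. -/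
open scoped Classical
open Matrix ComplexOrder

/-- The weighted sum `∑ xᵢ yᵢ yᵢ*` of rank-one Hermitian matrices. -/
noncomputable def weightedGram {ι m : Type*} [Fintype ι] (y : ι → m → ℂ) (x : ι → ℝ) :
    Matrix m m ℂ :=
  ∑ i, (x i : ℂ) • vecMulVec (y i) (star (y i))

section WeightedGram

variable {ι m : Type*} [Fintype m]

theorem det_add_smul_vecMulVec {M : Matrix m m ℂ} (hM : IsUnit M.det) (a : ℂ) (v w : m → ℂ) :
    (M + a • vecMulVec v w).det = M.det * (1 + a * (w ⬝ᵥ (M⁻¹ *ᵥ v))) := by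
  have h : a • vecMulVec v w = replicateCol Unit (a • v) * replicateRow Unit w := by
    rw [← vecMulVec_eq, smul_vecMulVec]
  rw [h, det_add_replicateCol_mul_replicateRow hM, det_unique (n := Unit), Matrix.mul_assoc,
    ← replicateCol_mulVec]
  simp [Matrix.add_apply, mulVec_smul]

theorem Matrix.PosDef.dotProduct_inv_mulVec_eq_re {M : Matrix m m ℂ} (hM : M.PosDef)
    (v : m → ℂ) : star v ⬝ᵥ (M⁻¹ *ᵥ v) = ((star v ⬝ᵥ (M⁻¹ *ᵥ v)).re : ℂ) ∧
      0 ≤ (star v ⬝ᵥ (M⁻¹ *ᵥ v)).re := by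
  have h := hM.inv.posSemidef.dotProduct_mulVec_nonneg v
  rw [Complex.nonneg_iff] at h
  exact ⟨Complex.ext rfl (by simpa using h.2.symm), h.1⟩

theorem Matrix.PosDef.det_re_add_smul_vecMulVec {M : Matrix m m ℂ} (hM : M.PosDef) (a : ℝ)
    (v : m → ℂ) : (M + (a : ℂ) • vecMulVec v (star v)).det.re =
      M.det.re * (1 + a * (star v ⬝ᵥ (M⁻¹ *ᵥ v)).re) := by
  rw [det_add_smul_vecMulVec hM.det_pos.ne'.isUnit, (hM.dotProduct_inv_mulVec_eq_re v).1,
    Complex.mul_re]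
  simp

theorem posSemidef_smul_vecMulVec {a : ℝ} (ha : 0 ≤ a) (v : m → ℂ) :
    ((a : ℂ) • vecMulVec v (star v)).PosSemidef :=
  (posSemidef_vecMulVec_self_star v).smul (by exact_mod_cast ha)

theorem Matrix.PosDef.add_sum_vecMulVec {M : Matrix m m ℂ} (hM : M.PosDef) (y : ι → m → ℂ)
    {x : ι → ℝ} (hx : ∀ i, 0 ≤ x i) (S : Finset ι) :
    (M + ∑ i ∈ S, (x i : ℂ) • vecMulVec (y i) (star (y i))).PosDef ∧
      M.det.re ≤ (M + ∑ i ∈ S, (x i : ℂ) • vecMulVec (y i) (star (y i))).det.re := by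
  induction S using Finset.induction_on with
  | empty => simpa using hM
  | insert i S hi ih =>
    rw [Finset.sum_insert hi, add_comm (_ • _), ← add_assoc]
    refine ⟨ih.1.add_posSemidef (posSemidef_smul_vecMulVec (hx i) _), ih.2.trans ?_⟩
    rw [ih.1.det_re_add_smul_vecMulVec]
    have h0 := (Complex.pos_iff.1 ih.1.det_pos).1
    have h1 := mul_nonneg (hx i) (ih.1.dotProduct_inv_mulVec_eq_re (y i)).2
    nlinarith

theorem weightedGram_eq_mul (y : m → m → ℂ) (x : m → ℝ) :
    weightedGram y x = (of y)ᵀ * diagonal (fun i => (x i : ℂ)) * (of y)ᵀᴴ := by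
  ext a b
  rw [Matrix.mul_apply, weightedGram, Matrix.sum_apply]
  refine Finset.sum_congr rfl fun i _ => ?_
  simp only [mul_diagonal, Matrix.smul_apply, vecMulVec_apply, conjTranspose_apply,
    transpose_apply, of_apply, smul_eq_mul, Pi.star_apply]
  ring

theorem weightedGram_posDef_of_square {y : m → m → ℂ} (hy : (of y).det ≠ 0) {x : m → ℝ}
    (hx : ∀ i, 0 < x i) : (weightedGram y x).PosDef := by
  rw [weightedGram_eq_mul]
  refine PosDef.mul_mul_conjTranspose_same ?_ ?_
  · exact posDef_diagonal_iff.2 fun i => by exact_mod_cast hx i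
  · rw [vecMul_injective_iff_isUnit, isUnit_iff_isUnit_det, det_transpose]
    exact hy.isUnit

theorem weightedGram_det_re_of_square (y : m → m → ℂ) (x : m → ℝ) :
    (weightedGram y x).det.re = ‖(of y).det‖ ^ 2 * ∏ i, x i := by
  have h : (weightedGram y x).det = ((‖(of y).det‖ ^ 2 * ∏ i, x i : ℝ) : ℂ) := by
    rw [weightedGram_eq_mul, det_mul, det_mul, det_conjTranspose, det_transpose, det_diagonal,
      mul_right_comm, ← starRingEnd_apply, Complex.mul_conj']
    push_cast
    rfl
  rw [h, Complex.ofReal_re]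

theorem weightedGram_eq_add [Fintype ι] {b : m → ι} (hb : Function.Injective b) (y : ι → m → ℂ)
    (x : ι → ℝ) : weightedGram y x = weightedGram (y ∘ b) (x ∘ b) +
      ∑ i ∈ (Finset.univ.image b)ᶜ, (x i : ℂ) • vecMulVec (y i) (star (y i)) := by
  rw [weightedGram, ← Finset.sum_add_sum_compl (Finset.univ.image b),
    Finset.sum_image fun _ _ _ _ h => hb h]
  rfl

theorem injective_of_det_ne_zero {y : ι → m → ℂ} {b : m → ι} (hb : (of (y ∘ b)).det ≠ 0) :
    Function.Injective b := by
  intro k l hkl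
  by_contra hne
  exact hb (det_zero_of_row_eq hne (by ext; simp [hkl]))

theorem weightedGram_posDef [Fintype ι] {y : ι → m → ℂ} {b : m → ι} (hb : (of (y ∘ b)).det ≠ 0)
    {x : ι → ℝ} (hx : ∀ i, 0 < x i) : (weightedGram y x).PosDef := by
  rw [weightedGram_eq_add (injective_of_det_ne_zero hb)]
  exact ((weightedGram_posDef_of_square hb fun i => hx (b i)).add_sum_vecMulVec y
    (fun i => (hx i).le) _).1

theorem le_weightedGram_det_re [Fintype ι] {y : ι → m → ℂ} {b : m → ι} (hb : (of (y ∘ b)).det ≠ 0)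
    {x : ι → ℝ} (hx : ∀ i, 0 < x i) :
    ‖(of (y ∘ b)).det‖ ^ 2 * ∏ k, x (b k) ≤ (weightedGram y x).det.re := by
  rw [weightedGram_eq_add (injective_of_det_ne_zero hb)]
  refine le_trans (weightedGram_det_re_of_square (y ∘ b) (x ∘ b)).ge ?_
  exact ((weightedGram_posDef_of_square hb fun i => hx (b i)).add_sum_vecMulVec y
    (fun i => (hx i).le) _).2

theorem exists_det_ne_zero [Finite ι] {y : ι → m → ℂ} (hy : Submodule.span ℂ (Set.range y) = ⊤) :
    ∃ b : m → ι, (of (y ∘ b)).det ≠ 0 := by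
  obtain ⟨κ, a, ha, hspan, hli⟩ := exists_linearIndependent' ℂ y
  have hfin : Finite κ := Finite.of_injective a ha
  have := Fintype.ofFinite κ
  let B : Module.Basis κ ℂ (m → ℂ) := Module.Basis.mk hli (by rw [hspan, hy])
  let e : m ≃ κ := (Pi.basisFun ℂ m).indexEquiv B
  refine ⟨a ∘ e, ?_⟩
  have h : LinearIndependent ℂ (of (y ∘ a ∘ e)).row := hli.comp e e.injective
  rw [linearIndependent_rows_iff_isUnit, isUnit_iff_isUnit_det] at h
  exact h.ne_zero

end WeightedGram

section Position

variable {ι m : Type*} [Fintype m]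

theorem eq_sum_det_updateRow (A : Matrix m m ℂ) (hA : A.det ≠ 0) (v : m → ℂ) :
    v = ∑ k, ((A.updateRow k v).det / A.det) • A k := by
  have h := mulVec_cramer Aᵀ v
  rw [det_transpose, mulVec_eq_sum] at h
  calc v = A.det⁻¹ • A.det • v := (inv_smul_smul₀ hA v).symm
    _ = _ := by
      rw [← h, Finset.smul_sum]
      refine Finset.sum_congr rfl fun k _ => ?_
      rw [cramer_transpose_apply, div_eq_inv_mul, mul_smul, op_smul_eq_smul]
      rfl

theorem sum_eq_sum_range_card_lt {κ : Type*} [Fintype κ] (t : κ → ℕ) {T : ℕ}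
    (hT : ∀ i, t i ≤ T) :
    ∑ i, t i = ∑ s ∈ Finset.range T, (Finset.univ.filter fun i => s < t i).card := by
  simp_rw [Finset.card_filter]
  rw [Finset.sum_comm]
  refine Finset.sum_congr rfl fun i _ => ?_
  rw [← Finset.card_filter]
  have : (Finset.range T).filter (fun s => s < t i) = Finset.range (t i) := by
    ext s
    have := hT i
    simp only [Finset.mem_filter, Finset.mem_range]
    omega
  rw [this, Finset.card_range]

theorem le_of_det_updateRow_ne_zero {y : ι → m → ℂ} {t : ι → ℕ} {b : m → ι}
    (hmax : ∀ b' : m → ι, (of (y ∘ b')).det ≠ 0 → ∑ k, t (b' k) ≤ ∑ k, t (b k)) {i : ι} {k : m}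
    (h : ((of (y ∘ b)).updateRow k (y i)).det ≠ 0) : t i ≤ t (b k) := by
  have h1 : (of (y ∘ b)).updateRow k (y i) = of (y ∘ Function.update b k i) := by
    rw [Function.comp_update]
    rfl
  have h2 := hmax _ (h1 ▸ h)
  have h3 : ∀ l, t (Function.update b k i l) = Function.update (t ∘ b) k (t i) l := fun l => by
    rw [← Function.comp_update]
    rfl
  simp_rw [h3] at h2
  rw [Finset.sum_update_of_mem (Finset.mem_univ k),
    ← Finset.add_sum_erase _ _ (Finset.mem_univ k), Finset.sdiff_singleton_eq_erase] at h2
  simpa using h2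

variable [Fintype ι]

/-- A basis of maximal weight in a vector configuration carries a fraction of the total weight,
as soon as no subspace contains too many of the vectors. -/
theorem mul_sum_le_mul_sum_of_maximal {y : ι → m → ℂ} {t : ι → ℕ} {b : m → ι}
    (hb : (of (y ∘ b)).det ≠ 0)
    (hmax : ∀ b' : m → ι, (of (y ∘ b')).det ≠ 0 → ∑ k, t (b' k) ≤ ∑ k, t (b k)) {c N : ℕ}
    (hcount : ∀ W : Submodule ℂ (m → ℂ),
      c * (Finset.univ.filter fun i => y i ∈ W).card ≤ N * Module.finrank ℂ W) :
    c * ∑ i, t i ≤ N * ∑ k, t (b k) := by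
  have hT : ∀ i, t i ≤ ∑ i, t i := fun i => Finset.single_le_sum (by simp) (Finset.mem_univ i)
  rw [sum_eq_sum_range_card_lt t hT, sum_eq_sum_range_card_lt (fun k => t (b k)) fun k => hT (b k),
    Finset.mul_sum, Finset.mul_sum]
  refine Finset.sum_le_sum fun s _ => ?_
  let K := Finset.univ.filter fun k => s < t (b k)
  let W := Submodule.span ℂ ((K.image (y ∘ b) : Finset (m → ℂ)) : Set (m → ℂ))
  have hsub : (Finset.univ.filter fun i => s < t i) ⊆ Finset.univ.filter fun i => y i ∈ W := by
    intro i hi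
    simp only [Finset.mem_filter, Finset.mem_univ, true_and] at hi ⊢
    rw [eq_sum_det_updateRow _ hb (y i)]
    refine Submodule.sum_mem _ fun k _ => ?_
    by_cases h : ((of (y ∘ b)).updateRow k (y i)).det = 0
    · simp [h]
    · refine Submodule.smul_mem _ _ (Submodule.subset_span ?_)
      have := le_of_det_updateRow_ne_zero hmax h
      exact Finset.mem_coe.2 (Finset.mem_image.2 ⟨k, by simp [K]; omega, rfl⟩)
  calc _ ≤ c * (Finset.univ.filter fun i => y i ∈ W).card :=
        Nat.mul_le_mul_left _ (Finset.card_le_card hsub)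
    _ ≤ N * Module.finrank ℂ W := hcount W
    _ ≤ N * K.card := Nat.mul_le_mul_left _
        ((finrank_span_finset_le_card _).trans Finset.card_image_le)

theorem exists_forall_le_log_norm_det (y : ι → m → ℂ) :
    ∃ C : ℝ, ∀ b : m → ι, C ≤ Real.log (‖(of (y ∘ b)).det‖ ^ 2) := by
  obtain ⟨C, hC⟩ := (Set.finite_range fun b : m → ι =>
    Real.log (‖(of (y ∘ b)).det‖ ^ 2)).bddBelow
  exact ⟨C, fun b => hC ⟨b, rfl⟩⟩

theorem exists_forall_le_log_weightedGram_det {y : ι → m → ℂ}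
    (hy : Submodule.span ℂ (Set.range y) = ⊤) {c N : ℕ}
    (hcount : ∀ W : Submodule ℂ (m → ℂ),
      c * (Finset.univ.filter fun i => y i ∈ W).card ≤ N * Module.finrank ℂ W)
    {q : ℝ} (hq : 1 < q) :
    ∃ C : ℝ, ∀ t : ι → ℕ, C ≤ N * Real.log (weightedGram y fun i => q ^ t i).det.re -
      c * (Real.log q * ∑ i, (t i : ℝ)) := by
  obtain ⟨C, hC⟩ := exists_forall_le_log_norm_det (m := m) y
  refine ⟨N * C, fun t => ?_⟩
  have hne : (Finset.univ.filter fun b : m → ι => (of (y ∘ b)).det ≠ 0).Nonempty := by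
    obtain ⟨b, hb⟩ := exists_det_ne_zero hy
    exact ⟨b, by simpa using hb⟩
  obtain ⟨b, hb, hmax⟩ := Finset.exists_max_image _ (fun b => ∑ k, t (b k)) hne
  simp only [Finset.mem_filter, Finset.mem_univ, true_and] at hb hmax
  have hle := mul_sum_le_mul_sum_of_maximal hb hmax hcount
  have hle' : (c : ℝ) * ∑ i, (t i : ℝ) ≤ N * ∑ k, (t (b k) : ℝ) := by exact_mod_cast hle
  have hq0 : 0 < q := by linarith
  have hdet := le_weightedGram_det_re hb (x := fun i => q ^ t i) fun i => pow_pos hq0 _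
  have hpos : 0 < ‖(of (y ∘ b)).det‖ ^ 2 := by positivity
  have hprod : 0 < ∏ k, q ^ t (b k) := Finset.prod_pos fun k _ => pow_pos hq0 _
  have hlog := Real.log_le_log (mul_pos hpos hprod) hdet
  rw [Real.log_mul hpos.ne' hprod.ne', Finset.prod_pow_eq_pow_sum, Real.log_pow q] at hlog
  push_cast at hlog
  have hlq := Real.log_pos hq
  have h1 : C + (∑ k, (t (b k) : ℝ)) * Real.log q ≤
      Real.log (weightedGram y fun i => q ^ t i).det.re := by linarith [hC b]
  have h2 := mul_le_mul_of_nonneg_left h1 (Nat.cast_nonneg (α := ℝ) N)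
  have h3 := mul_le_mul_of_nonneg_left hle' hlq.le
  nlinarith

/-- If no subspace contains too many of the vectors `yᵢ`, then for suitable positive weights all
leverage scores `xᵢ yᵢ* M⁻¹ yᵢ`, where `M = ∑ xᵢ yᵢ yᵢ*`, are large. -/
theorem exists_weights_leverage_gt {y : ι → m → ℂ} (hy : Submodule.span ℂ (Set.range y) = ⊤)
    {c N : ℕ} (hN : 0 < N) (hc : 0 < c)
    (hcount : ∀ W : Submodule ℂ (m → ℂ),
      c * (Finset.univ.filter fun i => y i ∈ W).card ≤ N * Module.finrank ℂ W) :
    ∃ x : ι → ℝ, (∀ i, 0 < x i) ∧ (weightedGram y x).PosDef ∧ ∀ i,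
      (c : ℝ) / (N + 2) < x i * (star (y i) ⬝ᵥ ((weightedGram y x)⁻¹ *ᵥ y i)).re := by
  have hN' : (0 : ℝ) < N := by exact_mod_cast hN
  have hc' : (0 : ℝ) < c := by exact_mod_cast hc
  set q : ℝ := 1 + (N : ℝ)⁻¹ with hqdef
  have hq : 1 < q := by rw [hqdef]; linarith [inv_pos.2 hN']
  have hq0 : 0 < q := by linarith
  obtain ⟨C, hC⟩ := exists_forall_le_log_weightedGram_det hy hcount hq
  set φ : (ι → ℕ) → ℝ := fun t => N * Real.log (weightedGram y fun i => q ^ t i).det.re -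
      c * (Real.log q * ∑ i, (t i : ℝ)) with hφ
  have hbdd : BddBelow (Set.range φ) := ⟨C, by rintro _ ⟨t, rfl⟩; exact hC t⟩
  have hδ : 0 < (c : ℝ) / (N + 1) - c / (N + 2) := by
    rw [sub_pos]
    gcongr
    norm_num
  obtain ⟨t, ht⟩ := exists_lt_of_ciInf_lt (lt_add_of_pos_right (iInf φ) hδ)
  obtain ⟨b, hb⟩ := exists_det_ne_zero hy
  have hM : (weightedGram y fun i => q ^ t i).PosDef :=
    weightedGram_posDef hb fun i => pow_pos hq0 _
  refine ⟨fun i => q ^ t i, fun i => pow_pos hq0 _, hM, fun i => ?_⟩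
  have hstep : φ t < φ (Function.update t i (t i + 1)) + (c / (N + 1) - c / (N + 2)) :=
    ht.trans_le (by linarith [ciInf_le hbdd (Function.update t i (t i + 1))])
  have hsum : ∑ j, ((Function.update t i (t i + 1) j : ℕ) : ℝ) = ∑ j, (t j : ℝ) + 1 := by
    have : ∑ j, Function.update t i (t i + 1) j = ∑ j, t j + 1 := by
      rw [Finset.sum_update_of_mem (Finset.mem_univ i),
        ← Finset.add_sum_erase _ t (Finset.mem_univ i), Finset.sdiff_singleton_eq_erase]
      ring
    exact_mod_cast this
  have hgram : (weightedGram y fun j => q ^ Function.update t i (t i + 1) j) =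
      (weightedGram y fun i => q ^ t i) +
        ((q ^ t i * (N : ℝ)⁻¹ : ℝ) : ℂ) • vecMulVec (y i) (star (y i)) := by
    rw [weightedGram, weightedGram, ← Finset.add_sum_erase _ _ (Finset.mem_univ i),
      ← Finset.add_sum_erase _ (fun j => ((q ^ t j : ℝ) : ℂ) • vecMulVec (y j) (star (y j)))
        (Finset.mem_univ i), add_right_comm, ← add_smul]
    congr 1
    · rw [Function.update_self, ← Complex.ofReal_add, pow_succ, ← mul_one_add, ← hqdef]
    · refine Finset.sum_congr rfl fun j hj => ?_
      rw [Function.update_of_ne (Finset.ne_of_mem_erase hj)]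
  set τ := q ^ t i * (star (y i) ⬝ᵥ ((weightedGram y fun i => q ^ t i)⁻¹ *ᵥ y i)).re with hτ
  have hτ0 : 0 ≤ τ := mul_nonneg (pow_pos hq0 _).le (hM.dotProduct_inv_mulVec_eq_re (y i)).2
  have hpos : 0 < 1 + (N : ℝ)⁻¹ * τ := by positivity
  have hdet : (weightedGram y fun j => q ^ Function.update t i (t i + 1) j).det.re =
      (weightedGram y fun i => q ^ t i).det.re * (1 + (N : ℝ)⁻¹ * τ) := by
    rw [hgram, hM.det_re_add_smul_vecMulVec, hτ]
    ring
  simp only [hφ] at hstep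
  rw [hsum, hdet, Real.log_mul (Complex.pos_iff.1 hM.det_pos).1.ne' hpos.ne'] at hstep
  have h1 := mul_le_mul_of_nonneg_left (Real.log_le_sub_one_of_pos hpos) hN'.le
  have h2 : (N : ℝ) * (1 + (N : ℝ)⁻¹ * τ - 1) = τ := by field_simp; ring
  have h3 : 1 / ((N : ℝ) + 1) ≤ Real.log q := by
    refine le_trans (le_of_eq ?_) (Real.one_sub_inv_le_log_of_pos hq0)
    rw [hqdef]
    field_simp
    ring
  have h4 := mul_le_mul_of_nonneg_left h3 hc'.le
  rw [mul_one_div] at h4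
  linarith

end Position

section Overlap

theorem three_quarters_le_of_gram_det_eq_zero {α β γ P Q R e : ℝ} (hα : 0 < α) (hβ : 0 < β)
    (hγ : 0 < γ) (hP : 0 ≤ P) (hQ : 0 ≤ Q) (hR : 0 ≤ R) (he : e ^ 2 ≤ P * Q * R)
    (hdet : α * β * γ + 2 * e = α * Q + β * R + γ * P) :
    3 / 4 ≤ P / (α * β) + Q / (β * γ) + R / (γ * α) := by
  set A := P / (α * β) with hA
  set B := Q / (β * γ) with hB
  set C := R / (γ * α) with hC
  have hA0 : 0 ≤ A := by positivity
  have hB0 : 0 ≤ B := by positivity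
  have hC0 : 0 ≤ C := by positivity
  set E := e / (α * β * γ) with hE
  have h1 : E ^ 2 ≤ A * B * C := by
    have : A * B * C = P * Q * R / (α * β * γ) ^ 2 := by
      rw [hA, hB, hC]; field_simp
    rw [this, hE, div_pow]
    gcongr
  have h2 : 1 + 2 * E = A + B + C := by
    rw [hA, hB, hC, hE]
    field_simp
    linarith
  by_contra! h
  have h3 : A * B * C * 27 ≤ (A + B + C) ^ 3 := by
    nlinarith [mul_nonneg hA0 (sq_nonneg (B - C)), mul_nonneg hB0 (sq_nonneg (A - C)),
      mul_nonneg hC0 (sq_nonneg (A - B)), mul_nonneg hA0 (sq_nonneg (A - C)),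
      mul_nonneg hA0 (sq_nonneg (A - B)), mul_nonneg hB0 (sq_nonneg (A - B)),
      mul_nonneg hB0 (sq_nonneg (B - C)), mul_nonneg hC0 (sq_nonneg (A - C)),
      mul_nonneg hC0 (sq_nonneg (B - C))]
  have h4 : (A + B + C) ^ 3 ≤ (3 / 4) ^ 3 := by gcongr
  have h5 : 1 / 64 < E ^ 2 := by nlinarith
  norm_num at h4
  linarith

variable {m : Type*} [Fintype m]

/-- The squared cosine of the angle between `u` and `v` for the form `u* P v`. -/
noncomputable def overlap (P : Matrix m m ℂ) (u v : m → ℂ) : ℝ :=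
  ‖star u ⬝ᵥ (P *ᵥ v)‖ ^ 2 / ((star u ⬝ᵥ (P *ᵥ u)).re * (star v ⬝ᵥ (P *ᵥ v)).re)

theorem star_dotProduct_mulVec_comm {P : Matrix m m ℂ} (hP : P.IsHermitian) (u v : m → ℂ) :
    star (star u ⬝ᵥ (P *ᵥ v)) = star v ⬝ᵥ (P *ᵥ u) := by
  rw [star_dotProduct, star_star, star_mulVec, hP.eq, ← dotProduct_mulVec]

theorem Matrix.PosDef.dotProduct_mulVec_eq_re {P : Matrix m m ℂ} (hP : P.PosDef) {v : m → ℂ}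
    (hv : v ≠ 0) : 0 < (star v ⬝ᵥ (P *ᵥ v)).re ∧
      star v ⬝ᵥ (P *ᵥ v) = ((star v ⬝ᵥ (P *ᵥ v)).re : ℂ) := by
  have h := Complex.pos_iff.1 (hP.dotProduct_mulVec_pos hv)
  exact ⟨h.1, Complex.ext rfl (by simpa using h.2.symm)⟩

theorem overlap_self {P : Matrix m m ℂ} (hP : P.PosDef) {v : m → ℂ} (hv : v ≠ 0) :
    overlap P v v = 1 := by
  obtain ⟨h0, h1⟩ := hP.dotProduct_mulVec_eq_re hv
  rw [overlap, h1, Complex.norm_real, Complex.ofReal_re, Real.norm_of_nonneg h0.le, ← sq,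
    div_self (by positivity)]

/-- Three coplanar lines through the origin cannot be pairwise too close to orthogonal. -/
theorem three_quarters_le_overlap {P : Matrix m m ℂ} (hP : P.PosDef) {u v w : m → ℂ}
    (hu : u ≠ 0) (hv : v ≠ 0) (hw : w ≠ 0) (h : w ∈ Submodule.span ℂ {u, v}) :
    3 / 4 ≤ overlap P u v + overlap P v w + overlap P w u := by
  obtain ⟨a, b, hab⟩ := Submodule.mem_span_pair.1 h
  obtain ⟨hu0, hu1⟩ := hP.dotProduct_mulVec_eq_re hu
  obtain ⟨hv0, hv1⟩ := hP.dotProduct_mulVec_eq_re hv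
  obtain ⟨hw0, hw1⟩ := hP.dotProduct_mulVec_eq_re hw
  have hlin : ∀ z : m → ℂ, star z ⬝ᵥ (P *ᵥ w) =
      a * (star z ⬝ᵥ (P *ᵥ u)) + b * (star z ⬝ᵥ (P *ᵥ v)) := fun z => by
    rw [← hab, mulVec_add, mulVec_smul, mulVec_smul, dotProduct_add, dotProduct_smul,
      dotProduct_smul, smul_eq_mul, smul_eq_mul]
  have e1 := hlin u
  have e2 := hlin v
  have e3 := hlin w
  have c1 := star_dotProduct_mulVec_comm hP.isHermitian u v
  have c2 := star_dotProduct_mulVec_comm hP.isHermitian v w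
  have c3 := star_dotProduct_mulVec_comm hP.isHermitian w u
  unfold overlap
  generalize star u ⬝ᵥ (P *ᵥ v) = p at *
  generalize star v ⬝ᵥ (P *ᵥ w) = q at *
  generalize star w ⬝ᵥ (P *ᵥ u) = r at *
  rw [← c1, hv1] at e2
  rw [← c2, hw1] at e3
  rw [← c3, hu1] at e1
  generalize (star u ⬝ᵥ (P *ᵥ u)).re = α at *
  generalize (star v ⬝ᵥ (P *ᵥ v)).re = β at *
  generalize (star w ⬝ᵥ (P *ᵥ w)).re = γ at *
  have hdet : (α * β * γ : ℂ) + (p * q * r + star (p * q * r)) =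
      α * (q * star q) + β * (r * star r) + γ * (p * star p) := by
    rw [star_mul', star_mul']
    linear_combination (α * β - p * star p : ℂ) * e3 + (star p * star q - β * r) * e1 +
      (p * r - α * star q) * e2
  refine three_quarters_le_of_gram_det_eq_zero (e := (p * q * r).re) hu0 hv0 hw0 (sq_nonneg _)
    (sq_nonneg _) (sq_nonneg _) ?_ ?_
  · rw [← mul_pow, ← mul_pow, ← norm_mul, ← norm_mul, ← sq_abs]
    gcongr
    exact Complex.abs_re_le_norm _
  · simp_rw [← starRingEnd_apply, Complex.mul_conj'] at hdet
    have := congrArg Complex.re hdet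
    rw [Complex.add_conj] at this
    exact_mod_cast this

theorem sum_overlap_eq {ι : Type*} [Fintype ι] {y : ι → m → ℂ} {x : ι → ℝ}
    (hM : (weightedGram y x).PosDef) (v : m → ℂ) :
    ∑ j, x j * ‖star v ⬝ᵥ ((weightedGram y x)⁻¹ *ᵥ y j)‖ ^ 2 =
      (star v ⬝ᵥ ((weightedGram y x)⁻¹ *ᵥ v)).re := by
  set M := weightedGram y x with hMdef
  set z := M⁻¹ *ᵥ v with hz
  have hMz : M *ᵥ z = v := by
    rw [hz, mulVec_mulVec, mul_nonsing_inv _ hM.det_pos.ne'.isUnit, one_mulVec]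
  have hterm : ∀ j, star v ⬝ᵥ (M⁻¹ *ᵥ y j) = star z ⬝ᵥ y j := fun j => by
    rw [hz, star_mulVec, hM.inv.isHermitian.eq, dotProduct_mulVec]
  have h : ((∑ j, x j * ‖star v ⬝ᵥ (M⁻¹ *ᵥ y j)‖ ^ 2 : ℝ) : ℂ) = star z ⬝ᵥ (M *ᵥ z) := by
    nth_rw 2 [hMdef]
    rw [weightedGram, sum_mulVec, dotProduct_sum]
    push_cast
    refine Finset.sum_congr rfl fun j _ => ?_
    rw [hterm, smul_mulVec, dotProduct_smul, vecMulVec_mulVec, op_smul_eq_smul, dotProduct_smul,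
      ← Complex.mul_conj', starRingEnd_apply, star_dotProduct (y j) z]
    simp only [smul_eq_mul]
    ring
  rw [hMz] at h
  rw [← Complex.ofReal_re (∑ j, _), h, star_dotProduct, Complex.star_def,
    Complex.conj_re]

end Overlap

section SylvesterGallai

/-- Averaging over ordered collinear triples, weighted so that all pairs count equally. -/
theorem card_mul_le_sum_of_triples {ι : Type*} [Fintype ι] {R : ι → ι → ι → Prop}
    {N : ι → ι → ℕ} {s : ι → ι → ℝ} (hcyc : ∀ i j k, R i j k → R j k i)
    (hN : ∀ i j, i ≠ j → N i j = (Finset.univ.filter fun k => R i j k).card)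
    (hNcyc : ∀ i j k, R i j k → N j k = N i j) (hne : ∀ i j k, R i j k → i ≠ j)
    (hpos : ∀ i j, i ≠ j → 0 < N i j)
    (hs : ∀ i j k, R i j k → 3 / 4 ≤ s i j + s j k + s k i) :
    (Fintype.card ι * (Fintype.card ι - 1) : ℝ) / 4 ≤ ∑ i, ∑ j, if i ≠ j then s i j else 0 := by
  have key : ∀ g : ι → ι → ℝ, ∑ i, ∑ j, (if i ≠ j then g i j else 0) =
      ∑ i, ∑ j, ∑ k, if R i j k then g i j / N i j else 0 := fun g => by
    refine Finset.sum_congr rfl fun i _ => Finset.sum_congr rfl fun j _ => ?_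
    split_ifs with hij
    · rw [← Finset.sum_filter, Finset.sum_const, ← hN i j hij, nsmul_eq_mul]
      have : (N i j : ℝ) ≠ 0 := by exact_mod_cast (hpos i j hij).ne'
      field_simp
    · exact (Finset.sum_eq_zero fun k _ => if_neg fun h => hij (hne i j k h)).symm
  have rot : ∀ f : ι → ι → ι → ℝ, ∑ i, ∑ j, ∑ k, f i j k = ∑ i, ∑ j, ∑ k, f j k i := fun f => by
    conv_rhs => rw [Finset.sum_comm]
    refine Finset.sum_congr rfl fun i _ => ?_
    rw [Finset.sum_comm]
  have hcard : ∑ i : ι, ∑ j : ι, (if i ≠ j then (1 : ℝ) else 0) =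
      Fintype.card ι * (Fintype.card ι - 1) := by
    have h : ∀ i j : ι, (if i ≠ j then (1 : ℝ) else 0) = 1 - if i = j then 1 else 0 :=
      fun i j => by by_cases hij : i = j <;> simp [hij]
    simp [h, Finset.sum_sub_distrib, mul_sub]
  have h3 : ∑ i : ι, ∑ j : ι, ∑ k : ι, (if R i j k then (3 / 4 : ℝ) / N i j else 0) ≤
      ∑ i, ∑ j, ∑ k, ((if R i j k then s i j / N i j else 0) +
        (if R j k i then s j k / N j k else 0) + if R k i j then s k i / N k i else 0) := by
    refine Finset.sum_le_sum fun i _ => Finset.sum_le_sum fun j _ => Finset.sum_le_sum fun k _ => ?_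
    by_cases h : R i j k
    · have h' := hcyc _ _ _ h
      rw [if_pos h, if_pos h, if_pos h', if_pos (hcyc _ _ _ h'), hNcyc _ _ _ h', hNcyc _ _ _ h,
        ← add_div, ← add_div]
      exact div_le_div_of_nonneg_right (hs _ _ _ h) (Nat.cast_nonneg _)
    · have h' : ¬ R j k i := fun h' => h (hcyc _ _ _ (hcyc _ _ _ h'))
      have h'' : ¬ R k i j := fun h'' => h (hcyc _ _ _ h'')
      simp [h, h', h'']
  simp only [Finset.sum_add_distrib] at h3
  rw [← rot fun i j k => if R i j k then s i j / N i j else 0,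
    ← (rot fun i j k => if R j k i then s j k / N j k else 0),
    ← rot fun i j k => if R i j k then s i j / N i j else 0, ← key fun _ _ => 3 / 4,
    ← key s] at h3
  have h4 : ∑ i : ι, ∑ j : ι, (if i ≠ j then (3 / 4 : ℝ) else 0) =
      3 / 4 * ∑ i : ι, ∑ j : ι, (if i ≠ j then (1 : ℝ) else 0) := by
    simp only [Finset.mul_sum, mul_ite, mul_one, mul_zero]
  rw [h4, hcard] at h3
  linarith

variable {ι E : Type*} [Fintype ι] [AddCommGroup E] [Module ℂ E] {y : ι → E}

theorem span_pair_eq_of_mem {u v w : E} (h : w ∈ Submodule.span ℂ {u, v})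
    (hwv : w ∉ Submodule.span ℂ {v}) :
    Submodule.span ℂ {v, w} = Submodule.span ℂ {u, v} := by
  refine le_antisymm ?_ ?_ <;>
    rw [Submodule.span_le, Set.insert_subset_iff, Set.singleton_subset_iff]
  · exact ⟨Submodule.subset_span (by simp), h⟩
  · refine ⟨?_, Submodule.subset_span (by simp)⟩
    rw [Set.pair_comm]
    exact mem_span_insert_exchange h hwv

/-- A proper subspace contains at most half of the points of a Sylvester–Gallai configuration. -/
theorem two_mul_card_mem_le (hind : ∀ i j, i ≠ j → y i ∉ Submodule.span ℂ {y j})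
    (hSG : ∀ i j, i ≠ j → ∃ k, k ≠ i ∧ k ≠ j ∧ y k ∈ Submodule.span ℂ {y i, y j})
    {W : Submodule ℂ E} {p : ι} (hp : y p ∉ W) :
    2 * (Finset.univ.filter fun i => y i ∈ W).card ≤ Fintype.card ι := by
  have hpair : ∀ {u v : E}, u ∈ W → v ∈ W → Submodule.span ℂ {u, v} ≤ W := fun hu hv => by
    rw [Submodule.span_le, Set.insert_subset_iff, Set.singleton_subset_iff]
    exact ⟨hu, hv⟩
  have hpq : ∀ q, y q ∈ W → p ≠ q := by
    rintro q hq rfl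
    exact hp hq
  choose r hrp hrq hr using fun q : {q // y q ∈ W} => hSG p q (hpq q q.2)
  set A := Finset.univ.filter fun i => y i ∈ W with hA
  have hcard : A.card ≤ Aᶜ.card := by
    refine Finset.card_le_card_of_injOn
      (fun q => if h : y q ∈ W then r ⟨q, h⟩ else q) ?_ ?_
    · intro q hq
      have hq : y q ∈ W := by simpa [hA] using hq
      simp only [dif_pos hq, Finset.coe_compl, Set.mem_compl_iff, Finset.mem_coe, hA,
        Finset.mem_filter, Finset.mem_univ, true_and]
      intro hrW
      exact hp (hpair hrW hq (mem_span_insert_exchange (hr ⟨q, hq⟩) (hind _ _ (hrq ⟨q, hq⟩))))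
    · intro q hq q' hq' heq
      have hq : y q ∈ W := by simpa [hA] using hq
      have hq' : y q' ∈ W := by simpa [hA] using hq'
      simp only [dif_pos hq, dif_pos hq'] at heq
      by_contra hne
      have h1 := span_pair_eq_of_mem (Set.pair_comm (y p) (y q) ▸ hr ⟨q, hq⟩) (hind _ _ (hrp _))
      have h2 := span_pair_eq_of_mem (Set.pair_comm (y p) (y q') ▸ hr ⟨q', hq'⟩) (hind _ _ (hrp _))
      rw [heq, h2] at h1
      have h3 : y q ∈ Submodule.span ℂ {y p, y q'} := by
        rw [Set.pair_comm, h1]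
        exact Submodule.subset_span (by simp)
      exact hp (hpair hq hq' (mem_span_insert_exchange h3 (hind _ _ hne)))
  have := A.card_add_card_compl
  omega

theorem four_mul_card_mem_le [FiniteDimensional ℂ E] (hdim : 4 ≤ Module.finrank ℂ E)
    (hspan : Submodule.span ℂ (Set.range y) = ⊤) (h0 : ∀ i, y i ≠ 0)
    (hind : ∀ i j, i ≠ j → y i ∉ Submodule.span ℂ {y j})
    (hSG : ∀ i j, i ≠ j → ∃ k, k ≠ i ∧ k ≠ j ∧ y k ∈ Submodule.span ℂ {y i, y j})
    (W : Submodule ℂ E) :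
    4 * (Finset.univ.filter fun i => y i ∈ W).card ≤ Fintype.card ι * Module.finrank ℂ W := by
  have hn : 4 ≤ Fintype.card ι := by
    have := finrank_range_le_card (R := ℂ) y
    rw [Set.finrank, hspan, finrank_top] at this
    omega
  by_cases hW : ∃ p, y p ∉ W
  · obtain ⟨p, hp⟩ := hW
    have h2 := two_mul_card_mem_le hind hSG hp
    rcases Nat.lt_or_ge (Module.finrank ℂ W) 2 with hlt | hge
    · interval_cases h : Module.finrank ℂ W
      · have hbot : W = ⊥ := Submodule.finrank_eq_zero.1 h
        have : (Finset.univ.filter fun i => y i ∈ W) = ∅ := by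
          simp [hbot, h0]
        simp [this]
      · have : (Finset.univ.filter fun i => y i ∈ W).card ≤ 1 := by
          refine Finset.card_le_one.2 fun i hi j hj => ?_
          simp only [Finset.mem_filter, Finset.mem_univ, true_and] at hi hj
          by_contra hij
          have hj0 : (⟨y j, hj⟩ : W) ≠ 0 := fun hz => h0 j (congrArg Subtype.val hz)
          obtain ⟨c, hc⟩ := (finrank_eq_one_iff_of_nonzero' _ hj0).1 h ⟨y i, hi⟩
          exact hind i j hij (Submodule.mem_span_singleton.2 ⟨c, congrArg Subtype.val hc⟩)
        omega
    · nlinarith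
  · push Not at hW
    have : W = ⊤ := by
      rw [← top_le_iff, ← hspan, Submodule.span_le]
      rintro _ ⟨i, rfl⟩
      exact hW i
    rw [this, finrank_top, mul_comm]
    exact Nat.mul_le_mul (Finset.card_le_univ _) hdim

theorem overlap_sum_lower {m : Type*} [Fintype m] {y : ι → m → ℂ} {P : Matrix m m ℂ}
    (hP : P.PosDef) (h0 : ∀ i, y i ≠ 0)
    (hind : ∀ i j, i ≠ j → y i ∉ Submodule.span ℂ {y j})
    (hSG : ∀ i j, i ≠ j → ∃ k, k ≠ i ∧ k ≠ j ∧ y k ∈ Submodule.span ℂ {y i, y j}) :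
    (Fintype.card ι * (Fintype.card ι + 3) : ℝ) / 4 ≤ ∑ i, ∑ j, overlap P (y i) (y j) := by
  let R : ι → ι → ι → Prop := fun i j k =>
    i ≠ j ∧ k ≠ i ∧ k ≠ j ∧ y k ∈ Submodule.span ℂ {y i, y j}
  let L : ι → ι → Finset ι := fun i j =>
    Finset.univ.filter fun k => y k ∈ Submodule.span ℂ {y i, y j}
  have hspan : ∀ i j k, R i j k →
      Submodule.span ℂ {y j, y k} = Submodule.span ℂ {y i, y j} := fun i j k h =>
    span_pair_eq_of_mem h.2.2.2 (hind _ _ h.2.2.1)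
  have hN : ∀ i j, i ≠ j →
      (L i j).card - 2 = (Finset.univ.filter fun k => R i j k).card := fun i j hij => by
    have h1 : (Finset.univ.filter fun k => R i j k) = L i j \ {i, j} := by
      ext k
      simp only [R, L, Finset.mem_filter, Finset.mem_univ, true_and, Finset.mem_sdiff,
        Finset.mem_insert, Finset.mem_singleton, not_or]
      tauto
    rw [h1, Finset.card_sdiff_of_subset, Finset.card_pair hij]
    intro k hk
    rw [Finset.mem_insert, Finset.mem_singleton] at hk
    refine Finset.mem_filter.2 ⟨Finset.mem_univ _, Submodule.subset_span ?_⟩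
    rcases hk with rfl | rfl <;> simp
  have hoff := card_mul_le_sum_of_triples (R := R) (N := fun i j => (L i j).card - 2)
    (s := fun i j => overlap P (y i) (y j)) ?_ (fun i j hij => by convert hN i j hij)
    ?_ ?_ ?_ ?_
  · have hsplit : ∀ i j, overlap P (y i) (y j) =
        (if i ≠ j then overlap P (y i) (y j) else 0) + if i = j then 1 else 0 := fun i j => by
      by_cases hij : i = j
      · subst hij
        simp [overlap_self hP (h0 i)]
      · simp [hij]
    rw [Finset.sum_congr rfl fun i _ => Finset.sum_congr rfl fun j _ => hsplit i j]
    simp only [Finset.sum_add_distrib, Finset.sum_ite_eq, Finset.mem_univ, if_true,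
      Finset.sum_const, Finset.card_univ, nsmul_eq_mul, mul_one]
    linarith
  · intro i j k h
    refine ⟨h.2.2.1.symm, h.1, h.2.1.symm, ?_⟩
    rw [hspan i j k h]
    exact Submodule.subset_span (by simp)
  · intro i j k h
    simp only [L, hspan i j k h]
  · exact fun i j k h => h.1
  · intro i j hij
    obtain ⟨k, hki, hkj, hk⟩ := hSG i j hij
    show 0 < (L i j).card - 2
    rw [hN i j hij]
    exact Finset.card_pos.2 ⟨k, Finset.mem_filter.2 ⟨Finset.mem_univ _, hij, hki, hkj, hk⟩⟩
  · exact fun i j k h => three_quarters_le_overlap hP (h0 i) (h0 j) (h0 k) h.2.2.2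

/-- The linear form of the Sylvester–Gallai theorem over `ℂ`. -/
theorem card_lt_four_of_sylvesterGallai {m : Type*} [Fintype m] {y : ι → m → ℂ}
    (hspan : Submodule.span ℂ (Set.range y) = ⊤) (h0 : ∀ i, y i ≠ 0)
    (hind : ∀ i j, i ≠ j → y i ∉ Submodule.span ℂ {y j})
    (hSG : ∀ i j, i ≠ j → ∃ k, k ≠ i ∧ k ≠ j ∧ y k ∈ Submodule.span ℂ {y i, y j}) :
    Fintype.card m < 4 := by
  by_contra! hm
  have hdim : 4 ≤ Module.finrank ℂ (m → ℂ) := by simpa using hm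
  have hn : 0 < Fintype.card ι := by
    have := finrank_range_le_card (R := ℂ) y
    rw [Set.finrank, hspan, finrank_top] at this
    omega
  obtain ⟨x, hx, hM, hlev⟩ := exists_weights_leverage_gt hspan hn (by norm_num : 0 < 4)
    (four_mul_card_mem_le hdim hspan h0 hind hSG)
  set P := (weightedGram y x)⁻¹
  have hP : P.PosDef := hM.inv
  have hcard : (0 : ℝ) < Fintype.card ι := by exact_mod_cast hn
  have hlow := overlap_sum_lower hP h0 hind hSG
  have hrow : ∀ i, ∑ j, overlap P (y i) (y j) ≤ (Fintype.card ι + 2) / 4 := fun i => by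
    have hi := (hP.dotProduct_mulVec_eq_re (h0 i)).1
    have hterm : ∀ j, overlap P (y i) (y j) ≤
        (Fintype.card ι + 2) / 4 / (star (y i) ⬝ᵥ (P *ᵥ y i)).re *
          (x j * ‖star (y i) ⬝ᵥ (P *ᵥ y j)‖ ^ 2) := fun j => by
      have hj := (hP.dotProduct_mulVec_eq_re (h0 j)).1
      have hl := hlev j
      rw [div_lt_iff₀ (by positivity)] at hl
      push_cast at hl
      rw [overlap, div_mul_eq_mul_div, div_le_div_iff₀ (by positivity) (by positivity)]
      have hnn : 0 ≤ ‖star (y i) ⬝ᵥ (P *ᵥ y j)‖ ^ 2 * (star (y i) ⬝ᵥ (P *ᵥ y i)).re := by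
        positivity
      nlinarith [mul_le_mul_of_nonneg_left hl.le hnn]
    refine (Finset.sum_le_sum fun j _ => hterm j).trans (le_of_eq ?_)
    rw [← Finset.mul_sum, sum_overlap_eq hM]
    exact div_mul_cancel₀ _ hi.ne'
  have hlt := Finset.sum_le_sum fun i (_ : i ∈ Finset.univ) => hrow i
  rw [Finset.sum_const, Finset.card_univ, nsmul_eq_mul] at hlt
  nlinarith

end SylvesterGallai

theorem finrank_span_lt_four_of_sylvesterGallai {ι E : Type*} [Fintype ι] [AddCommGroup E]
    [Module ℂ E] {w : ι → E} (h0 : ∀ i, w i ≠ 0)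
    (hind : ∀ i j, i ≠ j → w i ∉ Submodule.span ℂ {w j})
    (hSG : ∀ i j, i ≠ j → ∃ k, k ≠ i ∧ k ≠ j ∧ w k ∈ Submodule.span ℂ {w i, w j}) :
    Module.finrank ℂ (Submodule.span ℂ (Set.range w)) < 4 := by
  set U := Submodule.span ℂ (Set.range w) with hU
  have hfin : FiniteDimensional ℂ U := FiniteDimensional.span_of_finite ℂ (Set.finite_range w)
  let e := (Module.finBasis ℂ U).equivFun
  let g : (Fin (Module.finrank ℂ U) → ℂ) →ₗ[ℂ] E := U.subtype ∘ₗ e.symm.toLinearMap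
  have hg : Function.Injective g := U.injective_subtype.comp e.symm.injective
  let y : ι → Fin (Module.finrank ℂ U) → ℂ := fun i =>
    e ⟨w i, Submodule.subset_span (Set.mem_range_self i)⟩
  have hgy : ∀ i, g (y i) = w i := fun i => by simp [g, y]
  have hmem : ∀ i S, y i ∈ Submodule.span ℂ S ↔ w i ∈ Submodule.span ℂ (g '' S) := fun i S => by
    rw [← hgy, Submodule.apply_mem_span_image_iff_mem_span hg]
  have hspan : Submodule.span ℂ (Set.range y) = ⊤ := by
    refine Submodule.map_injective_of_injective hg ?_
    rw [Submodule.map_span, ← Set.range_comp, show g ∘ y = w from funext hgy, ← hU,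
      Submodule.map_top, LinearMap.range_comp, LinearEquiv.range, Submodule.map_top,
      Submodule.range_subtype]
  have := card_lt_four_of_sylvesterGallai hspan
    (fun i hi => h0 i (by rw [← hgy, hi, map_zero]))
    (fun i j hij => by
      rw [hmem, Set.image_singleton, hgy]
      exact hind i j hij)
    (fun i j hij => by
      obtain ⟨k, hki, hkj, hk⟩ := hSG i j hij
      refine ⟨k, hki, hkj, ?_⟩
      rwa [hmem, Set.image_pair, hgy, hgy])
  rwa [Fintype.card_fin] at this

theorem mem_span_pair_of_collinear {V : Type*} [AddCommGroup V] [Module ℂ V] {a b c : V}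
    (hab : a ≠ b) (h : Collinear ℂ ({a, b, c} : Set V)) :
    ((c, 1) : V × ℂ) ∈ Submodule.span ℂ {((a, 1) : V × ℂ), ((b, 1) : V × ℂ)} := by
  obtain ⟨u, hu⟩ := (collinear_iff_of_mem (p₀ := a) (by simp)).1 h
  obtain ⟨r, hr⟩ := hu b (by simp)
  obtain ⟨s, hs⟩ := hu c (by simp)
  have hr0 : r ≠ 0 := by
    rintro rfl
    exact hab (by simp [hr])
  refine Submodule.mem_span_pair.2 ⟨1 - s / r, s / r, Prod.ext ?_ ?_⟩
  · simp only [Prod.smul_mk, Prod.mk_add_mk]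
    rw [hr, hs, vadd_eq_add, vadd_eq_add, smul_add, smul_smul, div_mul_cancel₀ _ hr0]
    module
  · simp

theorem finrank_vectorSpan_le_finrank_span {ι V : Type*} [Finite ι] [AddCommGroup V] [Module ℂ V]
    (v : ι → V) : Module.finrank ℂ (vectorSpan ℂ (Set.range v)) ≤
      Module.finrank ℂ (Submodule.span ℂ (Set.range fun i => ((v i, 1) : V × ℂ))) := by
  have hfin := FiniteDimensional.span_of_finite ℂ
    (Set.finite_range fun i => ((v i, 1) : V × ℂ))
  rw [(Submodule.equivMapOfInjective (LinearMap.inl ℂ V ℂ) LinearMap.inl_injective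
    (vectorSpan ℂ (Set.range v))).finrank_eq]
  refine Submodule.finrank_mono ?_
  rw [vectorSpan, Submodule.map_span, Submodule.span_le]
  rintro _ ⟨_, ⟨_, ⟨i, rfl⟩, _, ⟨j, rfl⟩, rfl⟩, rfl⟩
  have h : LinearMap.inl ℂ V ℂ (v i -ᵥ v j) = ((v i, 1) : V × ℂ) - (v j, 1) := by simp
  rw [h]
  exact Submodule.sub_mem _ (Submodule.subset_span ⟨i, rfl⟩) (Submodule.subset_span ⟨j, rfl⟩)

/-- A `1`-SG configuration of distinct points in `ℂ^d` (for each `i`, the special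
lines through `vᵢ` — those containing a third point of the set — cover all `n`
points) has affine dimension at most `10`. -/
theorem one_sylvester_gallai_dim_le_ten {n d : ℕ}
    (v : Fin n → (Fin d → ℂ)) (hv : Function.Injective v)
    (hSG : ∀ i : Fin n, (n : ℝ) ≤
      ((Finset.univ.filter fun j : Fin n => j = i ∨ ∃ k : Fin n,
        k ≠ i ∧ k ≠ j ∧ j ≠ i ∧
        Collinear ℂ ({v i, v j, v k} : Set (Fin d → ℂ))).card : ℝ)) :
    Module.finrank ℂ (vectorSpan ℂ (Set.range v)) ≤ 10 := by
  have hthird : ∀ i j, i ≠ j → ∃ k, k ≠ i ∧ k ≠ j ∧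
      Collinear ℂ ({v i, v j, v k} : Set (Fin d → ℂ)) := fun i j hij => by
    have hcard := Nat.cast_le.1 (hSG i)
    have huniv := (Finset.card_eq_iff_eq_univ _).1
      (le_antisymm (Finset.card_le_univ _) (by rwa [Fintype.card_fin]))
    have hj := Finset.eq_univ_iff_forall.1 huniv j
    rw [Finset.mem_filter] at hj
    obtain ⟨k, hki, hkj, -, hk⟩ := hj.2.resolve_left hij.symm
    exact ⟨k, hki, hkj, hk⟩
  have hlt := finrank_span_lt_four_of_sylvesterGallai
    (w := fun i => ((v i, 1) : (Fin d → ℂ) × ℂ)) (fun i hi => one_ne_zero (congrArg Prod.snd hi))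
    (fun i j hij h => by
      obtain ⟨c, hc⟩ := Submodule.mem_span_singleton.1 h
      have hc1 : c = 1 := by simpa using congrArg Prod.snd hc
      rw [hc1, one_smul] at hc
      exact hij (hv (congrArg Prod.fst hc).symm))
    (fun i j hij => by
      obtain ⟨k, hki, hkj, hk⟩ := hthird i j hij
      exact ⟨k, hki, hkj, mem_span_pair_of_collinear (hv.ne hij) hk⟩)
  exact (finrank_vectorSpan_le_finrank_span v).trans (by omega)
end
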